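/- arXiv:2106.11831 — 2 statements merged into one kernel-verified Lean document; each statement's English description precedes it below -/
import Mathlib

section
/- As the real variable x tends to infinity, cos(π/(2x)) − cos(π/(2x) + δ₀(x)/2) − π⁵/(4x⁵) = O(1/x⁷); that is, the gap between the width upper bound cos(π/(2x)) and the width cos(π/(2x) + δ₀(x)/2) of the polygon D_x equals π⁵/(4x⁵) + O(1/x⁷). -/
open Real Filter Asymptotics

/-- `δ₀(x) = arctan(tan(2π/x)·tan(π/x)) − arcsin(sin(2π/x)·sin(π/x) / √(4·sin(π/x)² + cos(4π/x)))`. -/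
noncomputable def δ₀ (x : ℝ) : ℝ :=
  Real.arctan (Real.tan (2 * π / x) * Real.tan (π / x)) -
    Real.arcsin (Real.sin (2 * π / x) * Real.sin (π / x) /
      Real.sqrt (4 * Real.sin (π / x) ^ 2 + Real.cos (4 * π / x)))

theorem ContinuousAt.isBigO_const_one {f : ℝ → ℝ} {a : ℝ} (h : ContinuousAt f a) :
    f =O[nhds a] (fun _ => (1 : ℝ)) :=
  h.tendsto.isBigO_one ℝ

theorem isBigO_pow_pow_nhds_zero {m n : ℕ} (h : m ≤ n) :
    (fun t : ℝ => t ^ n) =O[nhds 0] (fun t : ℝ => t ^ m) := by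
  have h1 : (fun t : ℝ => t ^ (n - m)) =O[nhds 0] (fun _ => (1 : ℝ)) :=
    (continuous_pow (n - m)).continuousAt.isBigO_one ℝ
  refine ((isBigO_refl (fun t : ℝ => t ^ m) (nhds 0)).mul h1).congr
    (fun t => ?_) (fun t => mul_one _)
  rw [← pow_add, Nat.add_sub_cancel' h]

theorem Real.sin_sub_self_isBigO :
    (fun t : ℝ => Real.sin t - t) =O[nhds 0] (fun t : ℝ => t ^ 3) := by
  refine IsBigO.of_bound 1 ?_
  filter_upwards [Metric.ball_mem_nhds (0 : ℝ) one_pos] with t ht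
  have h1 : |t| ≤ 1 := by simpa using (mem_ball_zero_iff.mp ht).le
  have hb := Real.sin_bound h1
  have h5 : |t| ^ 5 ≤ |t| ^ 3 := pow_le_pow_of_le_one (abs_nonneg t) h1 (by norm_num)
  have h3 : |t ^ 3 / 6| = |t| ^ 3 / 6 := by rw [abs_div, abs_pow]; norm_num
  have ht : |Real.sin t - t| ≤ |Real.sin t - (t - t ^ 3 / 6)| + |t ^ 3 / 6| := by
    rw [show Real.sin t - t = (Real.sin t - (t - t ^ 3 / 6)) - t ^ 3 / 6 by ring]
    exact abs_sub _ _
  rw [Real.norm_eq_abs, Real.norm_eq_abs, abs_pow, one_mul]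
  have := pow_nonneg (abs_nonneg t) 3
  linarith

theorem Real.one_sub_cos_isBigO :
    (fun t : ℝ => 1 - Real.cos t) =O[nhds 0] (fun t : ℝ => t ^ 2) := by
  refine IsBigO.of_bound 1 (Eventually.of_forall fun t => ?_)
  rw [Real.norm_eq_abs, Real.norm_eq_abs, one_mul, abs_of_nonneg (sq_nonneg t),
    abs_of_nonneg (sub_nonneg.2 (Real.cos_le_one t))]
  nlinarith [Real.one_sub_sq_div_two_le_cos (x := t), sq_nonneg t]

theorem Real.arcsin_sub_self_isBigO :
    (fun t : ℝ => Real.arcsin t - t) =O[nhds 0] (fun t : ℝ => t ^ 3) := by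
  have hc : Tendsto Real.arcsin (nhds 0) (nhds 0) := by
    simpa using Real.continuous_arcsin.tendsto 0
  have hO : Real.arcsin =O[nhds 0] (fun t : ℝ => t) := by
    simpa using (Real.hasDerivAt_arcsin (x := 0) (by norm_num)
      (by norm_num)).differentiableAt.isBigO_sub
  refine ((Real.sin_sub_self_isBigO.comp_tendsto hc).neg_left.trans (hO.pow 3)).congr' ?_ .rfl
  filter_upwards [Icc_mem_nhds (show (-1 : ℝ) < 0 by norm_num) one_pos] with t ht
  simp [Real.sin_arcsin ht.1 ht.2]

theorem Real.arctan_sub_self_isBigO :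
    (fun t : ℝ => Real.arctan t - t) =O[nhds 0] (fun t : ℝ => t ^ 3) := by
  have hc : Tendsto Real.arctan (nhds 0) (nhds 0) := by
    simpa using Real.continuous_arctan.tendsto 0
  have hO : Real.arctan =O[nhds 0] (fun t : ℝ => t) := by
    simpa using (Real.hasDerivAt_arctan 0).differentiableAt.isBigO_sub
  have hinv : (fun w : ℝ => (Real.cos w)⁻¹) =O[nhds 0] (fun _ => (1 : ℝ)) :=
    ((Real.continuous_cos.continuousAt (x := 0)).inv₀ (by simp)).isBigO_one ℝ
  have htan : (fun w : ℝ => w - Real.tan w) =O[nhds 0] (fun w : ℝ => w ^ 3) := by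
    have h := (((isBigO_refl (fun w : ℝ => w) (nhds 0)).mul Real.one_sub_cos_isBigO).congr_right
      (fun w => (by ring : w * w ^ 2 = w ^ 3))).add Real.sin_sub_self_isBigO
    refine ((h.mul hinv).neg_left).congr' ?_ (.of_forall fun w => mul_one _)
    filter_upwards [Real.continuous_cos.continuousAt.eventually_ne
      (show Real.cos 0 ≠ 0 by simp)] with w hw
    rw [Real.tan_eq_sin_div_cos]
    field_simp
    ring
  refine ((htan.comp_tendsto hc).trans (hO.pow 3)).congr_left fun t => ?_
  simp [Real.tan_arctan]

theorem Real.sin_isBigO_self : Real.sin =O[nhds 0] (fun t : ℝ => t) := by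
  simpa using (Real.hasDerivAt_sin 0).differentiableAt.isBigO_sub

theorem Real.tan_two_mul_mul_tan {t : ℝ} (h : Real.cos t ≠ 0) :
    Real.tan (2 * t) * Real.tan t = 2 * Real.sin t ^ 2 / (1 - 2 * Real.sin t ^ 2) := by
  have h2 : Real.cos (2 * t) = 1 - 2 * Real.sin t ^ 2 := by
    rw [Real.cos_two_mul, Real.cos_sq']; ring
  rw [Real.tan_eq_sin_div_cos, Real.tan_eq_sin_div_cos, Real.sin_two_mul, h2, div_mul_div_comm,
    ← mul_div_mul_right _ (1 - 2 * Real.sin t ^ 2) h]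
  congr 1
  ring

theorem Real.cos_four_mul_eq (t : ℝ) :
    Real.cos (4 * t) = 1 - 8 * Real.sin t ^ 2 + 8 * Real.sin t ^ 4 := by
  rw [show 4 * t = 2 * (2 * t) by ring, Real.cos_two_mul, Real.cos_two_mul, Real.cos_sq']
  ring

theorem tan_mul_tan_sub_isBigO :
    (fun t : ℝ => Real.tan (2 * t) * Real.tan t - (2 * Real.sin t ^ 2 + 4 * Real.sin t ^ 4))
      =O[nhds 0] (fun t : ℝ => t ^ 6) := by
  have hg : (fun t : ℝ => 8 / (1 - 2 * Real.sin t ^ 2)) =O[nhds 0] (fun _ => (1 : ℝ)) :=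
    ContinuousAt.isBigO_const_one (ContinuousAt.div (by fun_prop) (by fun_prop) (by simp))
  refine ((Real.sin_isBigO_self.pow 6).mul hg).congr' ?_ (.of_forall fun t => mul_one _)
  have h1 : ∀ᶠ t : ℝ in nhds 0, 1 - 2 * Real.sin t ^ 2 ≠ 0 :=
    ContinuousAt.eventually_ne (by fun_prop) (by simp)
  filter_upwards [h1, Real.continuous_cos.continuousAt.eventually_ne
      (show Real.cos 0 ≠ 0 by simp)] with t h1 h2
  rw [Real.tan_two_mul_mul_tan h2, eq_sub_iff_add_eq, eq_div_iff h1, add_mul, mul_assoc,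
    div_mul_cancel₀ _ h1]
  ring

theorem sin_mul_sin_div_sqrt_sub_isBigO :
    (fun t : ℝ => Real.sin (2 * t) * Real.sin t /
        Real.sqrt (4 * Real.sin t ^ 2 + Real.cos (4 * t))
        - (2 * Real.sin t ^ 2 + 3 * Real.sin t ^ 4))
      =O[nhds 0] (fun t : ℝ => t ^ 6) := by
  set D : ℝ → ℝ := fun t => 4 * Real.sin t ^ 2 + Real.cos (4 * t) with hD
  set r : ℝ → ℝ := fun t => Real.cos t / Real.sqrt (D t) with hr
  have hDc : ContinuousAt D 0 := by fun_prop
  have hD0 : D 0 = 1 := by simp [hD]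
  have hrc : ContinuousAt r 0 :=
    ContinuousAt.div (by fun_prop) hDc.sqrt (by simp [hD0])
  have hr0 : r 0 = 1 := by simp [hr, hD0]
  have hqc : ContinuousAt (fun t => r t + 1 + 3 / 2 * Real.sin t ^ 2) 0 := by fun_prop
  have hq0 : r 0 + 1 + 3 / 2 * Real.sin 0 ^ 2 ≠ 0 := by norm_num [hr0]
  have hg : (fun t : ℝ => 2 * (7 / 4 - 15 * Real.sin t ^ 2 - 18 * Real.sin t ^ 4) /
      (D t * (r t + 1 + 3 / 2 * Real.sin t ^ 2))) =O[nhds 0] (fun _ => (1 : ℝ)) :=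
    ContinuousAt.isBigO_const_one (ContinuousAt.div (by fun_prop) (hDc.mul hqc)
      (mul_ne_zero (by simp [hD0]) hq0))
  refine ((Real.sin_isBigO_self.pow 6).mul hg).congr' ?_ (.of_forall fun t => mul_one _)
  filter_upwards [hqc.eventually_ne hq0,
    hDc.eventually_const_lt (show 0 < D 0 by simp [hD0])] with t hq hDt
  have hsq : r t ^ 2 * D t = 1 - Real.sin t ^ 2 := by
    simp only [hr]
    rw [div_pow, Real.sq_sqrt hDt.le, div_mul_cancel₀ _ hDt.ne', Real.cos_sq']
  have hz : Real.sin (2 * t) * Real.sin t / Real.sqrt (D t) = 2 * Real.sin t ^ 2 * r t := by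
    rw [Real.sin_two_mul]; simp only [hr]; ring
  have hDe : D t = 1 - 4 * Real.sin t ^ 2 + 8 * Real.sin t ^ 4 := by
    simp only [hD, Real.cos_four_mul_eq]; ring
  change _ = Real.sin (2 * t) * Real.sin t / Real.sqrt (D t) - _
  rw [hz, ← mul_div_assoc, div_eq_iff (mul_ne_zero hDt.ne' hq)]
  linear_combination (-2 * Real.sin t ^ 2) * hsq +
    2 * Real.sin t ^ 2 * (1 + 3 / 2 * Real.sin t ^ 2) ^ 2 * hDe

theorem Asymptotics.IsBigO.comp_sub_of_cubic {f g p : ℝ → ℝ}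
    (hf : (fun t => f t - t) =O[nhds 0] (fun t : ℝ => t ^ 3))
    (hp : p =O[nhds 0] (fun t : ℝ => t ^ 2))
    (hg : (fun t => g t - p t) =O[nhds 0] (fun t : ℝ => t ^ 6)) :
    (fun t => f (g t) - p t) =O[nhds 0] (fun t : ℝ => t ^ 6) := by
  have hO : g =O[nhds 0] (fun t : ℝ => t ^ 2) :=
    ((hg.trans (isBigO_pow_pow_nhds_zero (by norm_num))).add hp).congr_left fun t => by ring
  have hc : Tendsto g (nhds 0) (nhds 0) :=
    hO.trans_tendsto (by simpa using (continuous_pow (M := ℝ) 2).tendsto 0)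
  have h := ((hf.comp_tendsto hc).trans (hO.pow 3)).congr_right
    (fun t => (by ring : (t ^ 2) ^ 3 = t ^ 6))
  exact (h.add hg).congr_left fun t => by simp

theorem sin_pow_four_sub_isBigO :
    (fun t : ℝ => Real.sin t ^ 4 - t ^ 4) =O[nhds 0] (fun t : ℝ => t ^ 6) := by
  have h1 := Real.sin_isBigO_self.add (isBigO_refl (fun t : ℝ => t) (nhds 0))
  have h2 := (Real.sin_isBigO_self.pow 2).add (isBigO_refl (fun t : ℝ => t ^ 2) (nhds 0))
  exact ((Real.sin_sub_self_isBigO.mul h1).mul h2).congr (fun t => by ring) (fun t => by ring)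

/-- The expansion of `δ₀` in terms of the angle `t = π / x`. -/
theorem arctan_sub_arcsin_sub_isBigO :
    (fun t : ℝ => Real.arctan (Real.tan (2 * t) * Real.tan t) -
        Real.arcsin (Real.sin (2 * t) * Real.sin t /
          Real.sqrt (4 * Real.sin t ^ 2 + Real.cos (4 * t))) - t ^ 4)
      =O[nhds 0] (fun t : ℝ => t ^ 6) := by
  have hp : ∀ a : ℝ, (fun t : ℝ => 2 * Real.sin t ^ 2 + a * Real.sin t ^ 4)
      =O[nhds 0] (fun t : ℝ => t ^ 2) := fun a =>
    ((Real.sin_isBigO_self.pow 2).const_mul_left 2).add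
      (((Real.sin_isBigO_self.pow 4).trans
        (isBigO_pow_pow_nhds_zero (by norm_num))).const_mul_left a)
  have h1 := Real.arctan_sub_self_isBigO.comp_sub_of_cubic (hp 4) tan_mul_tan_sub_isBigO
  have h2 := Real.arcsin_sub_self_isBigO.comp_sub_of_cubic (hp 3)
    sin_mul_sin_div_sqrt_sub_isBigO
  exact ((h1.sub h2).add sin_pow_four_sub_isBigO).congr_left fun t => by ring

theorem cos_sub_cos_add_sub_isBigO {d : ℝ → ℝ}
    (hd : (fun t => d t - t ^ 4) =O[nhds 0] (fun t : ℝ => t ^ 6)) :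
    (fun t : ℝ => Real.cos (t / 2) - Real.cos (t / 2 + d t / 2) - t ^ 5 / 4)
      =O[nhds 0] (fun t : ℝ => t ^ 7) := by
  have hd4 : (fun t => d t / 2) =O[nhds 0] (fun t : ℝ => t ^ 4) :=
    (((hd.trans (isBigO_pow_pow_nhds_zero (by norm_num))).add
      (isBigO_refl (fun t : ℝ => t ^ 4) (nhds 0))).const_mul_left (1 / 2)).congr_left
      fun t => by ring
  have hd0 : Tendsto (fun t => d t / 2) (nhds 0) (nhds 0) :=
    hd4.trans_tendsto (by simpa using (continuous_pow (M := ℝ) 4).tendsto 0)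
  have ht0 : Tendsto (fun t : ℝ => t / 2) (nhds 0) (nhds 0) := by
    simpa using (continuous_id.div_const (2 : ℝ)).tendsto (0 : ℝ)
  have ht : (fun t : ℝ => t / 2) =O[nhds 0] (fun t : ℝ => t) :=
    ((isBigO_refl (fun t : ℝ => t) (nhds 0)).const_mul_left (1 / 2)).congr_left
      fun t => by ring
  have hcos : (fun t : ℝ => Real.cos (t / 2)) =O[nhds 0] (fun _ => (1 : ℝ)) :=
    ContinuousAt.isBigO_const_one (by fun_prop)
  have hsin : (fun t : ℝ => Real.sin (t / 2)) =O[nhds 0] (fun _ => (1 : ℝ)) :=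
    ContinuousAt.isBigO_const_one (by fun_prop)
  have h1 := (hcos.mul ((Real.one_sub_cos_isBigO.comp_tendsto hd0).trans
    (hd4.pow 2))).trans ((isBigO_pow_pow_nhds_zero (show 7 ≤ 8 by norm_num)).congr_left
      fun t => (by ring : t ^ 8 = 1 * (t ^ 4) ^ 2))
  have h2 := (hsin.mul ((Real.sin_sub_self_isBigO.comp_tendsto hd0).trans
    (hd4.pow 3))).trans ((isBigO_pow_pow_nhds_zero (show 7 ≤ 12 by norm_num)).congr_left
      fun t => (by ring : t ^ 12 = 1 * (t ^ 4) ^ 3))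
  have h3 := (((Real.sin_sub_self_isBigO.comp_tendsto ht0).trans (ht.pow 3)).mul
    hd4).congr_right fun t => (by ring : t ^ 3 * t ^ 4 = t ^ 7)
  have h4 := ((ht.mul hd).const_mul_left (1 / 2)).congr_right
    fun t => (by ring : t * t ^ 6 = t ^ 7)
  refine (((h1.add h2).add h3).add h4).congr_left fun t => ?_
  simp only [Function.comp_apply]
  rw [Real.cos_add]
  ring

theorem width_gap_Dn_isBigO :
    (fun x : ℝ => Real.cos (π / (2 * x)) - Real.cos (π / (2 * x) + δ₀ x / 2)
        - π ^ 5 / (4 * x ^ 5))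
      =O[atTop] (fun x : ℝ => 1 / x ^ 7) := by
  have ht : Tendsto (fun x : ℝ => π / x) atTop (nhds 0) := tendsto_const_nhds.div_atTop tendsto_id
  have h := (cos_sub_cos_add_sub_isBigO arctan_sub_arcsin_sub_isBigO).comp_tendsto ht
  have hr : (fun x : ℝ => (π / x) ^ 7) =O[atTop] (fun x : ℝ => 1 / x ^ 7) :=
    ((isBigO_refl (fun x : ℝ => 1 / x ^ 7) atTop).const_mul_left (π ^ 7)).congr_left
      fun x => by ring
  refine (h.trans hr).congr_left fun x => ?_
  simp only [Function.comp_apply, δ₀]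
  rw [show π / (2 * x) = π / x / 2 by ring, show 2 * π / x = 2 * (π / x) by ring,
    show 4 * π / x = 4 * (π / x) by ring, show π ^ 5 / (4 * x ^ 5) = (π / x) ^ 5 / 4 by ring]
end

section
/- As the real variable x tends to infinity, cos(π/(2x)) − cos(π/x − (1/2)·arcsin((1/2)·sin(2π/x))) − π⁴/(8x⁴) = O(1/x⁶); that is, the gap between the width upper bound cos(π/(2x)) and the width cos(π/x − (1/2)·arcsin((1/2)·sin(2π/x))) of the polygon B_x equals π⁴/(8x⁴) + O(1/x⁶). -/
open Real Filter Asymptotics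

open scoped Topology

theorem isBigO_continuous_mul_pow {p : ℝ → ℝ} (hp : Continuous p) (n : ℕ) :
    (fun t => p t * t ^ n) =O[𝓝 0] (fun t : ℝ => t ^ n) := by
  simpa using (hp.continuousAt.isBigO_one ℝ).mul (isBigO_refl (fun t : ℝ => t ^ n) (𝓝 0))

theorem isBigO_sin_sub_cubic :
    (fun t : ℝ => sin t - (t - t ^ 3 / 6)) =O[𝓝 0] (fun t : ℝ => t ^ 5) := by
  refine IsBigO.of_bound (1 / 100) ?_
  filter_upwards [Metric.closedBall_mem_nhds (0 : ℝ) one_pos] with t ht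
  have h := sin_bound (x := t) (by simpa using ht)
  rw [norm_pow, norm_eq_abs, norm_eq_abs]
  linarith

theorem isBigO_sin_sub_self :
    (fun t : ℝ => sin t - t) =O[𝓝 0] (fun t : ℝ => t ^ 3) := by
  have h := (isBigO_sin_sub_cubic.trans (isLittleO_pow_pow (by norm_num)).isBigO).add (isBigO_continuous_mul_pow (p := fun _ => -1 / 6) continuous_const 3)
  exact h.congr_left fun t => by ring

theorem isBigO_arcsin_half_sin_two_mul :
    (fun t : ℝ => arcsin (1 / 2 * sin (2 * t)) - (t - t ^ 3 / 2)) =O[𝓝 0]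
      (fun t : ℝ => t ^ 5) := by
  have hw : Tendsto (fun t : ℝ => t - t ^ 3 / 2) (𝓝 0) (𝓝 0) :=
    Continuous.tendsto' (by fun_prop) _ _ (by simp)
  have h2 : Tendsto (fun t : ℝ => 2 * t) (𝓝 0) (𝓝 0) :=
    Continuous.tendsto' (by fun_prop) _ _ (by simp)
  have hsin : Tendsto (fun t : ℝ => sin (t - t ^ 3 / 2)) (𝓝 0) (𝓝 0) :=
    Continuous.tendsto' (by fun_prop) _ _ (by simp)
  have hhalf : Tendsto (fun t : ℝ => 1 / 2 * sin (2 * t)) (𝓝 0) (𝓝 0) :=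
    Continuous.tendsto' (by fun_prop) _ _ (by simp)
  have hw5 : (fun t : ℝ => sin (t - t ^ 3 / 2) - ((t - t ^ 3 / 2) - (t - t ^ 3 / 2) ^ 3 / 6))
      =O[𝓝 0] (fun t : ℝ => t ^ 5) :=
    (isBigO_sin_sub_cubic.comp_tendsto hw).trans <|
      (isBigO_continuous_mul_pow (p := fun t => (1 - t ^ 2 / 2) ^ 5) (by fun_prop) 5).congr_left
        fun t => by simp only [Function.comp]; ring
  have h5 : (fun t : ℝ => sin (2 * t) - (2 * t - (2 * t) ^ 3 / 6))
      =O[𝓝 0] (fun t : ℝ => t ^ 5) :=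
    (isBigO_sin_sub_cubic.comp_tendsto h2).trans <|
      (isBigO_continuous_mul_pow (p := fun _ => 2 ^ 5) (by fun_prop) 5).congr_left
        fun t => by simp only [Function.comp]; ring
  have hdiff : (fun t : ℝ => 1 / 2 * sin (2 * t) - sin (t - t ^ 3 / 2))
      =O[𝓝 0] (fun t : ℝ => t ^ 5) :=
    (((h5.const_mul_left (1 / 2)).sub hw5).add (isBigO_continuous_mul_pow
      (p := fun t => -(1 / 4) + t ^ 2 / 8 - t ^ 4 / 48) (by fun_prop) 5)).congr_left
        fun t => by ring
  have harc : (fun p : ℝ × ℝ => arcsin p.1 - arcsin p.2) =O[𝓝 (0, 0)] fun p => p.1 - p.2 :=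
    (hasStrictDerivAt_arcsin (by norm_num) (by norm_num)).hasStrictFDerivAt.isBigO_sub
  refine IsBigO.trans (IsBigO.congr' (harc.comp_tendsto (hhalf.prodMk_nhds hsin)) ?_ .rfl) hdiff
  filter_upwards [hw.eventually (Icc_mem_nhds (by linarith [pi_pos] : -(π / 2) < 0)
    (by linarith [pi_pos] : 0 < π / 2))] with t ht
  simp only [Function.comp, arcsin_sin ht.1 ht.2]

theorem isBigO_cos_half_sub_cos_sub_half_arcsin :
    (fun t : ℝ => cos (t / 2) - cos (t - 1 / 2 * arcsin (1 / 2 * sin (2 * t))) - t ^ 4 / 8)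
      =O[𝓝 0] (fun t : ℝ => t ^ 6) := by
  set e : ℝ → ℝ := fun t => arcsin (1 / 2 * sin (2 * t)) - (t - t ^ 3 / 2) with he
  have he5 : e =O[𝓝 0] (fun t : ℝ => t ^ 5) := isBigO_arcsin_half_sin_two_mul
  have he3 : e =O[𝓝 0] (fun t : ℝ => t ^ 3) := he5.trans (isLittleO_pow_pow (by norm_num)).isBigO
  -- `d` is half the difference of the two angles and `y` is their mean.
  set d : ℝ → ℝ := fun t => t ^ 3 / 8 - e t / 4 with hd
  set y : ℝ → ℝ := fun t => t / 2 + d t with hy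
  have hd3 : d =O[𝓝 0] (fun t : ℝ => t ^ 3) :=
    ((isBigO_continuous_mul_pow (p := fun _ => 1 / 8) continuous_const 3).sub
      (he3.const_mul_left (1 / 4))).congr_left fun t => by simp only [hd]; ring
  have hy1 : y =O[𝓝 0] (fun t : ℝ => t) := by
    have h := (isBigO_continuous_mul_pow (p := fun _ => 1 / 2) continuous_const 1).add
      (hd3.trans (isLittleO_pow_pow (by norm_num)).isBigO)
    exact h.congr (fun t => by simp only [hy]; ring) fun t => pow_one t
  have hd0 : Tendsto d (𝓝 0) (𝓝 0) :=
    hd3.trans_tendsto (Continuous.tendsto' (by fun_prop) _ _ (by simp))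
  have hy0 : Tendsto y (𝓝 0) (𝓝 0) := hy1.trans_tendsto tendsto_id
  have hsd : (fun t => sin (d t) - t ^ 3 / 8) =O[𝓝 0] (fun t : ℝ => t ^ 5) := by
    have h9 : (fun t => sin (d t) - d t) =O[𝓝 0] (fun t : ℝ => t ^ 5) := by
      refine ((isBigO_sin_sub_self.comp_tendsto hd0).trans (hd3.pow 3)).trans ?_
      exact (isBigO_continuous_mul_pow (p := fun t => t ^ 4) (by fun_prop) 5).congr_left
        fun t => by ring
    exact (h9.sub (he5.const_mul_left (1 / 4))).congr_left fun t => by simp only [hd]; ring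
  have hsy3 : (fun t => sin (y t) - t / 2) =O[𝓝 0] (fun t : ℝ => t ^ 3) :=
    (((isBigO_sin_sub_self.comp_tendsto hy0).trans (hy1.pow 3)).add hd3).congr_left
      fun t => by simp only [hy, Function.comp]; ring
  have hsy1 : (fun t => sin (y t)) =O[𝓝 0] (fun t : ℝ => t) :=
    (isBigO_of_le _ fun t => by simpa using abs_sin_le_abs (x := y t)).trans hy1
  have h₁ := (hsy1.mul hsd).const_mul_left 2
  have h₂ := ((hsy3.mul (isBigO_refl (fun t : ℝ => t ^ 3) (𝓝 0))).const_mul_left (1 / 4))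
  refine ((h₁.congr_right fun t => by ring).add (h₂.congr_right fun t => by ring)).congr_left ?_
  intro t
  have hcos : cos (t / 2) - cos (t - 1 / 2 * arcsin (1 / 2 * sin (2 * t)))
      = 2 * (sin (y t) * sin (d t)) := by
    have ha : t / 2 = y t - d t := by simp only [hy]; ring
    have hb : t - 1 / 2 * arcsin (1 / 2 * sin (2 * t)) = y t + d t := by
      simp only [hy, hd, he]; ring
    rw [ha, hb, cos_sub (y t) (d t), cos_add (y t) (d t)]; ring
  rw [hcos]; ring

theorem width_gap_Bn_isBigO :
    (fun x : ℝ => Real.cos (π / (2 * x))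
        - Real.cos (π / x - (1 / 2) * Real.arcsin ((1 / 2) * Real.sin (2 * π / x)))
        - π ^ 4 / (8 * x ^ 4))
      =O[atTop] (fun x : ℝ => 1 / x ^ 6) := by
  have hlim : Tendsto (fun x : ℝ => π / x) atTop (𝓝 0) := tendsto_const_nhds.div_atTop tendsto_id
  refine ((isBigO_cos_half_sub_cos_sub_half_arcsin.comp_tendsto hlim).congr_left fun x => ?_).trans
    (((isBigO_refl (fun x : ℝ => 1 / x ^ 6) atTop).const_mul_left (π ^ 6)).congr_left fun x => ?_)
  · simp only [Function.comp]
    rw [show π / x / 2 = π / (2 * x) by rw [div_div, mul_comm], ← mul_div_assoc, div_pow, div_div,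
      mul_comm (x ^ 4)]
  · simp only [Function.comp, div_pow, mul_one_div]
end
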